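/- A (K,H,K_II)-linear Weingarten canal surface has a straight center curve: let a, b, c, d ∈ ℝ with c ≠ 0, suppose (EG − F²)(s,t) ≠ 0 and (eg − f²)(s,t) ≠ 0 for all (s,t), and a·K(s,t) + b·H(s,t) + c·K_II(s,t) = d for all (s,t). Then κ(s) = 0 for all s. -/

import Mathlib

open scoped RealInnerProductSpace

/-- Inner product of two vectors given by their coordinates in an orthonormal frame. -/
lemma inner_orthonormal_frame {V : Type*} [NormedAddCommGroup V] [InnerProductSpace ℝ V]
    {T N B : V} (hT : ‖T‖ = 1) (hN : ‖N‖ = 1) (hB : ‖B‖ = 1)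
    (hTN : ⟪T, N⟫ = 0) (hTB : ⟪T, B⟫ = 0) (hNB : ⟪N, B⟫ = 0)
    (x₁ x₂ x₃ y₁ y₂ y₃ : ℝ) :
    ⟪x₁ • T + x₂ • N + x₃ • B, y₁ • T + y₂ • N + y₃ • B⟫ = x₁ * y₁ + x₂ * y₂ + x₃ * y₃ := by
  have hNT : ⟪N, T⟫ = 0 := by rw [real_inner_comm, hTN]
  have hBT : ⟪B, T⟫ = 0 := by rw [real_inner_comm, hTB]
  have hBN : ⟪B, N⟫ = 0 := by rw [real_inner_comm, hNB]
  simp only [inner_add_left, inner_add_right, real_inner_smul_left, real_inner_smul_right,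
    real_inner_self_eq_norm_sq, hT, hN, hB, hTN, hTB, hNB, hNT, hBT, hBN]
  ring

/-- Derivative of a vector field given by its coordinates in a Frenet frame. -/
lemma hasDerivAt_frenet {V : Type*} [NormedAddCommGroup V] [NormedSpace ℝ V]
    {T N B : ℝ → V} {k τ s : ℝ} (hT : HasDerivAt T (k • N s) s)
    (hN : HasDerivAt N ((-k) • T s + τ • B s) s) (hB : HasDerivAt B ((-τ) • N s) s)
    {u v z : ℝ → ℝ} {u' v' z' : ℝ} (hu : HasDerivAt u u' s) (hv : HasDerivAt v v' s)
    (hz : HasDerivAt z z' s) :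
    HasDerivAt (fun x => u x • T x + v x • N x + z x • B x)
      ((u' - k * v s) • T s + (k * u s + v' - τ * z s) • N s + (τ * v s + z') • B s) s := by
  exact (((hu.smul hT).add (hv.smul hN)).add (hz.smul hB)).congr_deriv (by module)

/-- Product rule for two orthogonal fields. -/
lemma inner_deriv_eq_neg_of_orthogonal {V : Type*} [NormedAddCommGroup V] [InnerProductSpace ℝ V]
    {v n : ℝ → V} {v' n' : V} {s : ℝ} (hv : HasDerivAt v v' s) (hn : HasDerivAt n n' s)
    (h : ∀ u, ⟪v u, n u⟫ = 0) : ⟪v', n s⟫ = -⟪v s, n'⟫ := by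
  have h0 : HasDerivAt (fun u => ⟪v u, n u⟫) 0 s := by
    simpa only [h] using hasDerivAt_const s (0 : ℝ)
  linarith [(hv.inner ℝ hn).unique h0]

/-- The determinants of the second Gaussian curvature of a canal surface, in terms of
`X = w x - p₁` and `S = p w y + m τ`, where `m = 1 - p ^ 2` and `(x, y) = (cos t, sin t)`. -/
lemma canal_brioschi_numerator {r p p₁ p₂ w w₁ τ τ₁ x y m X S Sₛ Xₛ : ℝ} (hm : m = 1 - p ^ 2)
    (hm0 : m ≠ 0) (hxy : y ^ 2 = 1 - x ^ 2) (hX : X = w * x - p₁) (hS : S = p * w * y + m * τ)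
    (hXs : Xₛ = w₁ * x - p₂)
    (hSs : Sₛ = (p₁ * w + p * w₁) * y - 2 * p * p₁ * τ + m * τ₁)
    {e f g es et ett fs ft fst gs gt gss : ℝ}
    (he : e = -X - r * (X ^ 2 + S ^ 2) / m) (hf : f = r * S) (hg : g = -(r * m))
    (hes : es = -Xₛ - (p * (X ^ 2 + S ^ 2) + r * (2 * X * Xₛ + 2 * S * Sₛ)) / m
      - r * (X ^ 2 + S ^ 2) * (2 * p * p₁) / m ^ 2)
    (het : et = w * y - r * (-(2 * X * (w * y)) + 2 * S * (p * w * x)) / m)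
    (hett : ett = w * x - r * (2 * (w * y) ^ 2 - 2 * X * (w * x) + 2 * (p * w * x) ^ 2
      - 2 * S * (p * w * y)) / m)
    (hfs : fs = p * S + r * Sₛ) (hft : ft = r * (p * w * x))
    (hfst : fst = p * (p * w * x) + r * ((p₁ * w + p * w₁) * x))
    (hgs : gs = -(p * m) + 2 * r * p * p₁) (hgt : gt = 0)
    (hgss : gss = -(p₁ * m) + 4 * p ^ 2 * p₁ + 2 * r * (p₁ ^ 2 + p * p₂)) :
    Matrix.det !![-(1 / 2) * ett + fst - (1 / 2) * gss, (1 / 2) * es, fs - (1 / 2) * et;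
        ft - (1 / 2) * gs, e, f; (1 / 2) * gt, f, g] -
      Matrix.det !![0, (1 / 2) * et, (1 / 2) * gs; (1 / 2) * et, e, f; (1 / 2) * gs, f, g] =
    -(r / 2) * X ^ 2 * (m + r * X) * (m + 2 * r * X) + m / 4 * (r * w ^ 2 * m * x ^ 2
      + (-(r * p * w₁ * m) + 2 * r * p₁ * w * m - 2 * r * p₁ * w + w * m ^ 2 - w * m) * x
      + (r * p * p₂ * m - 2 * r * p₁ ^ 2 * m + 2 * r * p₁ ^ 2 - r * w ^ 2 * m - p₁ * m ^ 2 + p₁ * m)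
      + r * p * w * τ * m * y) := by
  have hp : p ^ 2 = 1 - m := by linarith
  rw [← sub_eq_zero]
  simp only [Matrix.det_fin_three, Matrix.of_apply, Matrix.cons_val', Matrix.cons_val_zero,
    Matrix.cons_val_one, Matrix.cons_val]
  subst hX hS hXs hSs he hf hg hes het hett hfs hft hfst hgs hgt hgss
  clear hm
  field_simp
  ring_nf
  simp only [hxy, hp]
  ring

/-- A trigonometric polynomial identity whose quartic part factors through `w x - p`. -/
lemma quadratic_coeff_eq_zero_of_factored_quartic {w r m p A₀ A₁ c₀ c₁ c₂ c₃ : ℝ}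
    (hw : w ≠ 0) (hr : r ≠ 0)
    (h : ∀ x y : ℝ, x ^ 2 + y ^ 2 = 1 →
      (w * x - p) ^ 2 * (m + r * (w * x - p)) * (A₀ + A₁ * (w * x - p))
        + (c₂ * x ^ 2 + c₁ * x + c₀ + c₃ * y) = 0) : c₂ = 0 := by
  have e0 := h 0 1 (by norm_num)
  have e0' := h 0 (-1) (by norm_num)
  have e1 := h 1 0 (by norm_num)
  have e1' := h (-1) 0 (by norm_num)
  have e2 := h (3 / 5) (4 / 5) (by norm_num)
  have e2' := h (3 / 5) (-(4 / 5)) (by norm_num)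
  have e3 := h (-(3 / 5)) (4 / 5) (by norm_num)
  have e3' := h (-(3 / 5)) (-(4 / 5)) (by norm_num)
  have q0 := congrArg₂ (· + ·) e0 e0'
  have q2 := congrArg₂ (· + ·) e2 e2'
  have q3 := congrArg₂ (· + ·) e3 e3'
  have h1 : A₁ = 0 := by
    have : r * w ^ 4 * A₁ = 0 := by
      ring_nf at q0 q2 q3 e1 e1' ⊢
      linarith
    simpa [hw, hr] using this
  have h0 : A₀ = 0 := by
    subst h1
    have : r * w ^ 3 * A₀ = 0 := by
      ring_nf at q0 q2 q3 e1 e1' ⊢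
      linarith
    simpa [hw, hr] using this
  subst h0 h1
  ring_nf at q0 q2 q3 e1 e1' ⊢
  linarith

/-- Clearing denominators in the linear Weingarten relation of a canal surface. -/
lemma weingarten_clear_denominators {a b c d r X m Δ : ℝ} (hr : r ≠ 0) (hX : X ≠ 0)
    (hP : m + r * X ≠ 0)
    (h : a * (r * X * (m + r * X) / (r ^ 2 * (m + r * X) ^ 2))
      + b * (-(r * (m + r * X) * (m + 2 * r * X)) / (2 * (r ^ 2 * (m + r * X) ^ 2)))
      + c * ((r * X * (m + r * X))⁻¹ ^ 2 *
        (-(r / 2) * X ^ 2 * (m + r * X) * (m + 2 * r * X) + m / 4 * Δ)) = d) :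
    X ^ 2 * (m + r * X) * ((-((b + c) * r * m / 2) - d * r ^ 2 * m)
      + (a * r - (b + c) * r ^ 2 - d * r ^ 3) * X) + c * m / 4 * Δ = 0 := by
  subst h
  obtain ⟨P, hPm⟩ : ∃ P, P = m + r * X := ⟨_, rfl⟩
  obtain rfl : m = P - r * X := by linarith
  rw [sub_add_cancel] at hP ⊢
  field_simp
  ring

theorem KHKII_linear_Weingarten_straight_center
    (α T N B : ℝ → EuclideanSpace ℝ (Fin 3)) (κ τ r : ℝ → ℝ)
    (hα : ContDiff ℝ (⊤ : ℕ∞) α) (hT : ContDiff ℝ (⊤ : ℕ∞) T)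
    (hN : ContDiff ℝ (⊤ : ℕ∞) N) (hB : ContDiff ℝ (⊤ : ℕ∞) B)
    (hκ : ContDiff ℝ (⊤ : ℕ∞) κ) (hτ : ContDiff ℝ (⊤ : ℕ∞) τ)
    (hr : ContDiff ℝ (⊤ : ℕ∞) r)
    (hTα : ∀ s, T s = deriv α s)
    (hT1 : ∀ s, ‖T s‖ = 1) (hN1 : ∀ s, ‖N s‖ = 1) (hB1 : ∀ s, ‖B s‖ = 1)
    (hTN : ∀ s, ⟪T s, N s⟫ = 0) (hTB : ∀ s, ⟪T s, B s⟫ = 0)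
    (hNB : ∀ s, ⟪N s, B s⟫ = 0)
    (hT' : ∀ s, deriv T s = κ s • N s)
    (hN' : ∀ s, deriv N s = (-κ s) • T s + τ s • B s)
    (hB' : ∀ s, deriv B s = (-τ s) • N s)
    (hrpos : ∀ s, 0 < r s) (hr1 : ∀ s, |deriv r s| < 1)
    (R Q : ℝ → ℝ)
    (hR : ∀ s, R s = r s * deriv r s)
    (hQ : ∀ s, Q s = r s * Real.sqrt (1 - (deriv r s) ^ 2))
    (C : ℝ → ℝ → EuclideanSpace ℝ (Fin 3))
    (hC : ∀ s t, C s t = α s - R s • T s - (Q s * Real.cos t) • N s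
      + (Q s * Real.sin t) • B s)
    (Cs Ct : ℝ → ℝ → EuclideanSpace ℝ (Fin 3))
    (hCs : ∀ s t, Cs s t = deriv (fun u => C u t) s)
    (hCt : ∀ s t, Ct s t = deriv (fun u => C s u) t)
    (E F G : ℝ → ℝ → ℝ)
    (hE : ∀ s t, E s t = ⟪Cs s t, Cs s t⟫)
    (hF : ∀ s t, F s t = ⟪Cs s t, Ct s t⟫)
    (hG : ∀ s t, G s t = ⟪Ct s t, Ct s t⟫)
    (n : ℝ → ℝ → EuclideanSpace ℝ (Fin 3))
    (hn : ∀ s t, n s t = (r s)⁻¹ • (C s t - α s))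
    (Css Cst Ctt : ℝ → ℝ → EuclideanSpace ℝ (Fin 3))
    (hCss : ∀ s t, Css s t = deriv (fun u => Cs u t) s)
    (hCst : ∀ s t, Cst s t = deriv (fun u => Cs s u) t)
    (hCtt : ∀ s t, Ctt s t = deriv (fun u => Ct s u) t)
    (e f g : ℝ → ℝ → ℝ)
    (he : ∀ s t, e s t = ⟪Css s t, n s t⟫)
    (hf : ∀ s t, f s t = ⟪Cst s t, n s t⟫)
    (hg : ∀ s t, g s t = ⟪Ctt s t, n s t⟫)
    (K : ℝ → ℝ → ℝ)
    (hK : ∀ s t, K s t = (e s t * g s t - f s t ^ 2) / (E s t * G s t - F s t ^ 2))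
    (H : ℝ → ℝ → ℝ)
    (hH : ∀ s t, H s t = (E s t * g s t - 2 * F s t * f s t + G s t * e s t)
      / (2 * (E s t * G s t - F s t ^ 2)))
    (es et ett fs ft fst gs gt gss : ℝ → ℝ → ℝ)
    (hes : ∀ s t, es s t = deriv (fun u => e u t) s)
    (het : ∀ s t, et s t = deriv (fun u => e s u) t)
    (hett : ∀ s t, ett s t = deriv (fun u => et s u) t)
    (hfs : ∀ s t, fs s t = deriv (fun u => f u t) s)
    (hft : ∀ s t, ft s t = deriv (fun u => f s u) t)
    (hfst : ∀ s t, fst s t = deriv (fun u => fs s u) t)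
    (hgs : ∀ s t, gs s t = deriv (fun u => g u t) s)
    (hgt : ∀ s t, gt s t = deriv (fun u => g s u) t)
    (hgss : ∀ s t, gss s t = deriv (fun u => gs u t) s)
    (KII : ℝ → ℝ → ℝ)
    (hKII : ∀ s t, KII s t = (e s t * g s t - f s t ^ 2)⁻¹ ^ 2 *
      (Matrix.det !![-(1 / 2) * ett s t + fst s t - (1 / 2) * gss s t,
          (1 / 2) * es s t, fs s t - (1 / 2) * et s t;
          ft s t - (1 / 2) * gs s t, e s t, f s t;
          (1 / 2) * gt s t, f s t, g s t] -
        Matrix.det !![0, (1 / 2) * et s t, (1 / 2) * gs s t;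
          (1 / 2) * et s t, e s t, f s t;
          (1 / 2) * gs s t, f s t, g s t]))
    (a b c d : ℝ) (hc : c ≠ 0)
    (hreg : ∀ s t, E s t * G s t - F s t ^ 2 ≠ 0)
    (hreg2 : ∀ s t, e s t * g s t - f s t ^ 2 ≠ 0)
    (hlin : ∀ s t : ℝ, a * K s t + b * H s t + c * KII s t = d)
    :
    ∀ s : ℝ, κ s = 0 := by
  by_contra hcon
  push Not at hcon
  obtain ⟨s₀, hs₀⟩ := hcon
  set p := deriv r with hp_def
  have hp : ContDiff ℝ (⊤ : ℕ∞) p := (contDiff_infty_iff_deriv.1 hr).2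
  set q : ℝ → ℝ := fun s => Real.sqrt (1 - p s ^ 2) with hq_def
  have hm0 : ∀ s, 0 < 1 - p s ^ 2 := fun s => by
    have := (sq_lt_one_iff_abs_lt_one (p s)).2 (hr1 s)
    linarith
  have hq0 : ∀ s, q s ≠ 0 := fun s => (Real.sqrt_pos.2 (hm0 s)).ne'
  have hq2 : ∀ s, q s ^ 2 = 1 - p s ^ 2 := fun s => Real.sq_sqrt (hm0 s).le
  have hq : ContDiff ℝ (⊤ : ℕ∞) q :=
    (contDiff_const.sub (hp.pow 2)).sqrt fun s => (hm0 s).ne'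
  set w : ℝ → ℝ := fun s => q s * κ s with hw_def
  have hw : ContDiff ℝ (⊤ : ℕ∞) w := hq.mul hκ
  have hasDeriv : ∀ {V : Type} [NormedAddCommGroup V] [NormedSpace ℝ V] {h : ℝ → V},
      ContDiff ℝ (⊤ : ℕ∞) h → ∀ s, HasDerivAt h (deriv h s) s := fun hh s =>
    (hh.differentiable (by simp) s).hasDerivAt
  have dr : ∀ s, HasDerivAt r (p s) s := hasDeriv hr
  have dp := hasDeriv hp
  have dp₁ := hasDeriv (contDiff_infty_iff_deriv.1 hp).2
  have dw := hasDeriv hw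
  have dτ := hasDeriv hτ
  have dT : ∀ s, HasDerivAt T (κ s • N s) s := fun s => hT' s ▸ hasDeriv hT s
  have dN : ∀ s, HasDerivAt N ((-κ s) • T s + τ s • B s) s := fun s => hN' s ▸ hasDeriv hN s
  have dB : ∀ s, HasDerivAt B ((-τ s) • N s) s := fun s => hB' s ▸ hasDeriv hB s
  have dα : ∀ s, HasDerivAt α (T s) s := fun s => hTα s ▸ hasDeriv hα s
  set p₁ := deriv p with hp₁_def
  have dq : ∀ s, HasDerivAt q (-(p s * p₁ s) / q s) s := fun s => by
    refine ((((dp s).pow 2).const_sub 1).sqrt (hm0 s).ne').congr_deriv ?_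
    have := hq0 s
    simp only [hq_def] at this ⊢
    field_simp
    norm_num
    field_simp
  -- the unit normal and its derivatives
  have n_eq : ∀ s t, n s t = (-p s) • T s + (-(q s * Real.cos t)) • N s
      + (q s * Real.sin t) • B s := fun s t => by
    have h := (hrpos s).ne'
    rw [hn, hC, hR, hQ]
    have : α s - (r s * p s) • T s - (r s * √(1 - p s ^ 2) * Real.cos t) • N s
        + (r s * √(1 - p s ^ 2) * Real.sin t) • B s - α s
        = r s • ((-p s) • T s + (-(q s * Real.cos t)) • N s + (q s * Real.sin t) • B s) := by
      simp only [hq_def]; module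
    rw [this, inv_smul_smul₀ h]
  have C_eq : ∀ s t, C s t = α s + r s • n s t := fun s t => by
    rw [hn, smul_inv_smul₀ (hrpos s).ne']; abel
  set X : ℝ → ℝ → ℝ := fun s t => w s * Real.cos t - p₁ s with hX_def
  set S : ℝ → ℝ → ℝ := fun s t => p s * w s * Real.sin t + (1 - p s ^ 2) * τ s with hS_def
  set ν₂ : ℝ → ℝ → ℝ := fun s t => -((p s * X s t * Real.cos t + S s t * Real.sin t) / q s)
    with hν₂_def
  set ν₃ : ℝ → ℝ → ℝ := fun s t => (p s * X s t * Real.sin t - S s t * Real.cos t) / q s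
    with hν₃_def
  have dns : ∀ s t, HasDerivAt (fun u => n u t)
      (X s t • T s + ν₂ s t • N s + ν₃ s t • B s) s := fun s t => by
    simp only [n_eq]
    refine (hasDerivAt_frenet (dT s) (dN s) (dB s) (dp s).neg
      ((dq s).mul_const (Real.cos t)).neg ((dq s).mul_const (Real.sin t))).congr_deriv ?_
    have hqs := hq0 s
    have hq2s := hq2 s
    have hxy := Real.sin_sq t
    simp only [hX_def, hS_def, hν₂_def, hν₃_def, hw_def, ← hq2s, Pi.neg_apply]
    generalize Real.sin t = y at hxy ⊢
    generalize Real.cos t = x at hxy ⊢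
    congr 1
    · congr 2
      · ring
      · field_simp
        linear_combination (p s * q s * κ s ) * hxy
    · congr 1
      field_simp
      ring
  have dnt : ∀ s t, HasDerivAt (fun u => n s u)
      ((0 : ℝ) • T s + (q s * Real.sin t) • N s + (q s * Real.cos t) • B s) t := fun s t => by
    simp only [n_eq]
    refine (((hasDerivAt_const t ((-p s) • T s)).add
      (((Real.hasDerivAt_cos t).const_mul (q s)).neg.smul_const (N s))).add
      (((Real.hasDerivAt_sin t).const_mul (q s)).smul_const (B s))).congr_deriv ?_
    module
  -- first derivatives of the surface
  have Cs_eq : ∀ s t, Cs s t = (1 - p s ^ 2 + r s * X s t) • T s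
      + (-(p s * q s * Real.cos t) + r s * ν₂ s t) • N s
      + (p s * q s * Real.sin t + r s * ν₃ s t) • B s := fun s t => by
    rw [hCs]
    simp only [C_eq]
    refine ((dα s).add ((dr s).smul (dns s t))).deriv.trans ?_
    rw [n_eq]
    module
  have Ct_eq : ∀ s t, Ct s t = (0 : ℝ) • T s + (r s * q s * Real.sin t) • N s
      + (r s * q s * Real.cos t) • B s := fun s t => by
    rw [hCt]
    simp only [C_eq]
    refine (((dnt s t).const_smul (r s)).const_add (α s)).deriv.trans ?_
    module
  have inner_frame := fun s => inner_orthonormal_frame (hT1 s) (hN1 s) (hB1 s) (hTN s) (hTB s)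
    (hNB s)
  have inner_frame := fun s => inner_orthonormal_frame (hT1 s) (hN1 s) (hB1 s) (hTN s) (hTB s)
    (hNB s)
  have Cs_n : ∀ s t, ⟪Cs s t, n s t⟫ = 0 := fun s t => by
    have hqs := hq0 s
    rw [Cs_eq, n_eq, inner_frame]
    simp only [hν₂_def, hν₃_def]
    field_simp
    linear_combination (p s * q s ^ 2 + r s * p s * X s t) * Real.sin_sq t + p s * hq2 s
  have Ct_n : ∀ s t, ⟪Ct s t, n s t⟫ = 0 := fun s t => by
    rw [Ct_eq, n_eq, inner_frame]; ring
  have dX : ∀ s t, HasDerivAt (fun u => X u t) (deriv w s * Real.cos t - deriv p₁ s) s :=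
    fun s t => ((dw s).mul_const _).sub (dp₁ s)
  have dXt : ∀ s t, HasDerivAt (fun u => X s u) (-(w s * Real.sin t)) t := fun s t =>
    (((Real.hasDerivAt_cos t).const_mul _).sub_const _).congr_deriv (by ring)
  have dS : ∀ s t, HasDerivAt (fun u => S u t)
      ((p₁ s * w s + p s * deriv w s) * Real.sin t - 2 * p s * p₁ s * τ s
        + (1 - p s ^ 2) * deriv τ s) s := fun s t =>
    ((((dp s).mul (dw s)).mul_const _).add ((((dp s).pow 2).const_sub 1).mul (dτ s))).congr_deriv
      (by simp; ring)
  have dSt : ∀ s t, HasDerivAt (fun u => S s u) (p s * w s * Real.cos t) t := fun s t =>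
    ((Real.hasDerivAt_sin t).const_mul _).add_const _
  have dCs_s : ∀ s t, HasDerivAt (fun u => Cs u t) (Css s t) s := fun s t => by
    rw [hCss]
    refine DifferentiableAt.hasDerivAt ?_
    have := (dX s t).differentiableAt
    have := (dS s t).differentiableAt
    have := (dp s).differentiableAt
    have := (dr s).differentiableAt
    have := (dq s).differentiableAt
    have := (dT s).differentiableAt
    have := (dN s).differentiableAt
    have := (dB s).differentiableAt
    have := hq0 s
    simp only [Cs_eq, hν₂_def, hν₃_def]
    fun_prop (disch := assumption)
  have dCs_t : ∀ s t, HasDerivAt (fun u => Cs s u) (Cst s t) t := fun s t => by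
    rw [hCst]
    refine DifferentiableAt.hasDerivAt ?_
    have := (dXt s t).differentiableAt
    have := (dSt s t).differentiableAt
    simp only [Cs_eq, hν₂_def, hν₃_def]
    fun_prop
  have dCt_t : ∀ s t, HasDerivAt (fun u => Ct s u) (Ctt s t) t := fun s t => by
    rw [hCtt]
    refine DifferentiableAt.hasDerivAt ?_
    simp only [Ct_eq]
    fun_prop
  -- the fundamental forms
  have hE' : ∀ s t, E s t
      = ((1 - p s ^ 2 + r s * X s t) ^ 2 + r s ^ 2 * S s t ^ 2) / (1 - p s ^ 2) := fun s t => by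
    have hqs := hq0 s
    rw [hE, Cs_eq, inner_frame]
    simp only [hν₂_def, hν₃_def, ← hq2]
    field_simp
    linear_combination (p s ^ 2 * (q s ^ 2 + r s * X s t) ^ 2 + r s ^ 2 * S s t ^ 2)
      * Real.sin_sq t + (q s ^ 2 + r s * X s t) ^ 2 * hq2 s
  have hF' : ∀ s t, F s t = -(r s ^ 2 * S s t) := fun s t => by
    have hqs := hq0 s
    rw [hF, Cs_eq, Ct_eq, inner_frame]
    simp only [hν₂_def, hν₃_def]
    field_simp
    linear_combination -(r s ^ 2 * S s t) * Real.sin_sq t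
  have hG' : ∀ s t, G s t = r s ^ 2 * (1 - p s ^ 2) := fun s t => by
    rw [hG, Ct_eq, inner_frame, ← hq2]
    linear_combination r s ^ 2 * q s ^ 2 * Real.sin_sq t
  have he' : ∀ s t, e s t = -X s t - r s * (X s t ^ 2 + S s t ^ 2) / (1 - p s ^ 2) := fun s t => by
    have hqs := hq0 s
    rw [he, inner_deriv_eq_neg_of_orthogonal (dCs_s s t) (dns s t) fun u => Cs_n u t, Cs_eq,
      inner_frame]
    simp only [hν₂_def, hν₃_def, ← hq2]
    field_simp
    linear_combination -(p s ^ 2 * X s t * (q s ^ 2 + r s * X s t) + r s * S s t ^ 2)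
      * Real.sin_sq t - X s t * (q s ^ 2 + r s * X s t) * hq2 s
  have hf' : ∀ s t, f s t = r s * S s t := fun s t => by
    have hqs := hq0 s
    rw [hf, inner_deriv_eq_neg_of_orthogonal (dCs_t s t) (dnt s t) (Cs_n s), Cs_eq, inner_frame]
    simp only [hν₂_def, hν₃_def]
    field_simp
    linear_combination r s * S s t * Real.sin_sq t
  have hg' : ∀ s t, g s t = -(r s * (1 - p s ^ 2)) := fun s t => by
    rw [hg, inner_deriv_eq_neg_of_orthogonal (dCt_t s t) (dnt s t) (Ct_n s), Ct_eq, inner_frame,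
      ← hq2]
    linear_combination -(r s * q s ^ 2) * Real.sin_sq t
  -- derivatives of the second fundamental form
  have hm0' : ∀ s, 1 - p s ^ 2 ≠ 0 := fun s => (hm0 s).ne'
  have dm : ∀ s, HasDerivAt (fun u => 1 - p u ^ 2) (-(2 * p s * p₁ s)) s := fun s =>
    (((dp s).pow 2).const_sub 1).congr_deriv (by simp)
  have hes' := fun s t => (hes s t).trans <| by
    simp only [he']
    exact ((dX s t).neg.sub (((dr s).mul (((dX s t).pow 2).add ((dS s t).pow 2))).div (dm s)
      (hm0' s))).deriv
  have het' : ∀ s t, et s t = w s * Real.sin t - r s * (-(2 * X s t * (w s * Real.sin t))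
      + 2 * S s t * (p s * w s * Real.cos t)) / (1 - p s ^ 2) := fun s t => by
    rw [het]
    simp only [he']
    refine ((dXt s t).neg.sub (((((dXt s t).pow 2).add ((dSt s t).pow 2)).const_mul
      (r s)).div_const _)).deriv.trans ?_
    simp
  have hett' : ∀ s t, ett s t = w s * Real.cos t - r s * (2 * (w s * Real.sin t) ^ 2
      - 2 * X s t * (w s * Real.cos t) + 2 * (p s * w s * Real.cos t) ^ 2
      - 2 * S s t * (p s * w s * Real.sin t)) / (1 - p s ^ 2) := fun s t => by
    rw [hett]
    simp only [het']
    have dsin := (Real.hasDerivAt_sin t).const_mul (w s)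
    refine (dsin.sub ((((((dXt s t).const_mul 2).mul dsin).neg.add (((dSt s t).const_mul 2).mul
      ((Real.hasDerivAt_cos t).const_mul (p s * w s)))).const_mul (r s)).div_const
        _)).deriv.trans ?_
    ring
  have hfs' : ∀ s t, fs s t = p s * S s t + r s * ((p₁ s * w s + p s * deriv w s) * Real.sin t
      - 2 * p s * p₁ s * τ s + (1 - p s ^ 2) * deriv τ s) := fun s t => by
    rw [hfs]
    simp only [hf']
    exact ((dr s).mul (dS s t)).deriv
  have hft' : ∀ s t, ft s t = r s * (p s * w s * Real.cos t) := fun s t => by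
    rw [hft]
    simp only [hf']
    exact ((dSt s t).const_mul (r s)).deriv
  have hfst' : ∀ s t, fst s t = p s * (p s * w s * Real.cos t)
      + r s * ((p₁ s * w s + p s * deriv w s) * Real.cos t) := fun s t => by
    rw [hfst]
    simp only [hfs']
    exact (((dSt s t).const_mul (p s)).add (((((Real.hasDerivAt_sin t).const_mul _).sub_const
      _).add_const _).const_mul (r s))).deriv
  have hgs' : ∀ s t, gs s t = -(p s * (1 - p s ^ 2)) + 2 * r s * p s * p₁ s := fun s t => by
    rw [hgs]
    simp only [hg']
    refine ((dr s).mul (dm s)).neg.deriv.trans ?_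
    ring
  have hgt' : ∀ s t, gt s t = 0 := fun s t => by
    rw [hgt]
    simp only [hg', deriv_const]
  have hgss' : ∀ s t, gss s t = -(p₁ s * (1 - p s ^ 2)) + 4 * p s ^ 2 * p₁ s
      + 2 * r s * (p₁ s ^ 2 + p s * deriv p₁ s) := fun s t => by
    rw [hgss]
    simp only [hgs']
    refine (((dp s).mul (dm s)).neg.add ((((dr s).const_mul 2).mul (dp s)).mul
      (dp₁ s))).deriv.trans ?_
    simp only [Pi.mul_apply]
    ring
  have hrs := (hrpos s₀).ne'
  have hms := hm0' s₀
  have hws : w s₀ ≠ 0 := mul_ne_zero (hq0 s₀) hs₀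
  have hnum := fun t => canal_brioschi_numerator (r := r s₀) (rfl : 1 - p s₀ ^ 2 = 1 - p s₀ ^ 2)
    hms (Real.sin_sq t) (rfl : X s₀ t = _) (rfl : S s₀ t = _) rfl rfl (he' s₀ t) (hf' s₀ t)
    (hg' s₀ t) ((hes' s₀ t).trans (by simp; field_simp; ring)) (het' s₀ t) (hett' s₀ t)
    (hfs' s₀ t) (hft' s₀ t) (hfst' s₀ t) (hgs' s₀ t) (hgt' s₀ t) (hgss' s₀ t)
  have hD : ∀ t, e s₀ t * g s₀ t - f s₀ t ^ 2
      = r s₀ * X s₀ t * (1 - p s₀ ^ 2 + r s₀ * X s₀ t) := fun t => by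
    rw [he', hf', hg']
    field_simp
    ring
  have hJ : ∀ t, E s₀ t * G s₀ t - F s₀ t ^ 2
      = r s₀ ^ 2 * (1 - p s₀ ^ 2 + r s₀ * X s₀ t) ^ 2 := fun t => by
    rw [hE', hF', hG']
    field_simp
    ring
  have hW : ∀ t, E s₀ t * g s₀ t - 2 * F s₀ t * f s₀ t + G s₀ t * e s₀ t
      = -(r s₀ * (1 - p s₀ ^ 2 + r s₀ * X s₀ t) * (1 - p s₀ ^ 2 + 2 * r s₀ * X s₀ t)) :=
    fun t => by
    rw [hE', hF', hG', he', hf', hg']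
    field_simp
    ring
  have hpoly := fun t => by
    have hl := hlin s₀ t
    have hD0 := hreg2 s₀ t
    rw [hK, hH, hKII, hnum, hJ, hW, hD] at hl
    rw [hD] at hD0
    have hX0 : X s₀ t ≠ 0 := by rintro h; simp [h] at hD0
    have hP0 : 1 - p s₀ ^ 2 + r s₀ * X s₀ t ≠ 0 := by rintro h; simp [h] at hD0
    exact weingarten_clear_denominators hrs hX0 hP0 hl
  have hlast := quadratic_coeff_eq_zero_of_factored_quartic (m := 1 - p s₀ ^ 2) (p := p₁ s₀)
    (A₀ := -((b + c) * r s₀ * (1 - p s₀ ^ 2) / 2) - d * r s₀ ^ 2 * (1 - p s₀ ^ 2))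
    (A₁ := a * r s₀ - (b + c) * r s₀ ^ 2 - d * r s₀ ^ 3)
    (c₀ := c * (1 - p s₀ ^ 2) / 4 * (r s₀ * p s₀ * deriv p₁ s₀ * (1 - p s₀ ^ 2)
      - 2 * r s₀ * p₁ s₀ ^ 2 * (1 - p s₀ ^ 2) + 2 * r s₀ * p₁ s₀ ^ 2
      - r s₀ * w s₀ ^ 2 * (1 - p s₀ ^ 2) - p₁ s₀ * (1 - p s₀ ^ 2) ^ 2
      + p₁ s₀ * (1 - p s₀ ^ 2)))
    (c₁ := c * (1 - p s₀ ^ 2) / 4 * (-(r s₀ * p s₀ * deriv w s₀ * (1 - p s₀ ^ 2))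
      + 2 * r s₀ * p₁ s₀ * w s₀ * (1 - p s₀ ^ 2) - 2 * r s₀ * p₁ s₀ * w s₀
      + w s₀ * (1 - p s₀ ^ 2) ^ 2 - w s₀ * (1 - p s₀ ^ 2)))
    (c₂ := c * (1 - p s₀ ^ 2) / 4 * (r s₀ * w s₀ ^ 2 * (1 - p s₀ ^ 2)))
    (c₃ := c * (1 - p s₀ ^ 2) / 4 * (r s₀ * p s₀ * w s₀ * τ s₀ * (1 - p s₀ ^ 2)))
    hws hrs fun x y hxy => by
      obtain ⟨t, rfl, rfl⟩ : ∃ t, Real.cos t = x ∧ Real.sin t = y := by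
        have hz : ‖(⟨x, y⟩ : ℂ)‖ = 1 := by
          rw [Complex.norm_eq_sqrt_sq_add_sq, hxy, Real.sqrt_one]
        refine ⟨Complex.arg ⟨x, y⟩, ?_, ?_⟩
        · rw [Complex.cos_arg (norm_ne_zero_iff.1 (by rw [hz]; exact one_ne_zero)), hz, div_one]
        · rw [Complex.sin_arg, hz, div_one]
      linear_combination hpoly t
  simp [hc, hrs, hws, hms] at hlast
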